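/- Assume that the degrees are ordered d_1 ≤ d_2 ≤ ⋯ ≤ d_k and that the singular locus V_sing of V is finite. Then there exist homogeneous polynomials a_{j,i} ∈ ℂ[X_0,…,X_N] of degree d_j − d_i (for 1 ≤ i < j ≤ k) such that, setting f_j' = f_j + Σ_{i<j} a_{j,i} f_i, the following hold: the common zero set of f_1', …, f_k' in ℙ^N(ℂ) equals V, and for every j = 1, …, k, every point [x] of Z_j = {[x] ∈ ℙ^N(ℂ) : f_j'(x) = ⋯ = f_k'(x) = 0} at which the gradients d_x f_j', …, d_x f_k' are linearly dependent over ℂ lies in V_sing. -/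

import Mathlib

open MvPolynomial

/-- The gradient (vector of partial derivatives) of a polynomial `f` evaluated at `x`. -/
noncomputable def pgrad {N : ℕ} (f : MvPolynomial (Fin (N + 1)) ℂ) (x : Fin (N + 1) → ℂ) :
    Fin (N + 1) → ℂ :=
  fun i => eval x (pderiv i f)

/-- Over a field of characteristic zero, algebraically independent elements have linearly
independent Kähler differentials. -/
theorem AlgebraicIndependent.linearIndependent_kaehlerDifferential
    {K L τ : Type*} [Field K] [CharZero K] [Field L] [Algebra K L] [Algebra.EssFiniteType K L]
    {t : τ → L} (ht : AlgebraicIndependent K t) :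
    LinearIndependent L fun m => KaehlerDifferential.D K L (t m) := by
  let R := MvPolynomial τ K
  let : Algebra R L := (aeval t).toAlgebra
  have : IsScalarTower K R L := IsScalarTower.of_algHom (aeval t)
  have : FaithfulSMul R L := (faithfulSMul_iff_algebraMap_injective R L).2 ht
  let : Algebra (FractionRing R) L := FractionRing.liftAlgebra R L
  have : IsScalarTower K (FractionRing R) L := IsScalarTower.to₁₃₄ K R (FractionRing R) L
  have : Algebra.EssFiniteType (FractionRing R) L := .of_comp K _ _
  have : CharZero (FractionRing R) :=
    charZero_of_injective_algebraMap (R := K) (algebraMap K _).injective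
  have : Algebra.FormallySmooth R (FractionRing R) := .of_isLocalization (nonZeroDivisors R)
  have : Algebra.FormallySmooth R L := .comp R (FractionRing R) L
  have hinj : Function.Injective (KaehlerDifferential.mapBaseChange K R L) := by
    rw [← LinearMap.ker_eq_bot,
      (Algebra.H1Cotangent.exact_δ_mapBaseChange K R L).linearMap_ker_eq, LinearMap.range_eq_bot]
    exact Subsingleton.elim _ _
  have hb := (((KaehlerDifferential.mvPolynomialBasis K τ).baseChange L).linearIndependent).map'
    _ (LinearMap.ker_eq_bot.2 hinj)
  have hX : ∀ m, algebraMap R L (X m) = t m := fun m => aeval_X t m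
  have hfun : (fun m => KaehlerDifferential.D K L (t m)) =
      KaehlerDifferential.mapBaseChange K R L ∘
        (KaehlerDifferential.mvPolynomialBasis K τ).baseChange L := by
    funext m
    simp [← hX, R]
  rw [hfun]
  exact hb

/-- The chain rule for a derivation applied to a polynomial expression. -/
theorem Derivation.map_mvPolynomial_aeval {R A M σ : Type*} [CommRing R] [CommRing A]
    [Algebra R A] [AddCommGroup M] [Module A M] [Module R M] [IsScalarTower R A M] [Fintype σ]
    (D : Derivation R A M) (y : σ → A) (p : MvPolynomial σ R) :
    D (aeval y p) = ∑ i, aeval y (pderiv i p) • D (y i) := by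
  classical
  induction p using MvPolynomial.induction_on with
  | C a => simp
  | add p q hp hq => simp [hp, hq, add_smul, Finset.sum_add_distrib]
  | mul_X p n hp =>
    simp [hp, pderiv_X, add_smul, Finset.sum_add_distrib, Finset.smul_sum, smul_smul,
      Pi.single_apply, mul_comm, apply_ite, ite_smul, add_comm]

/-- If the `G_l(t, x)` vanish at a point `y = (t, x)` of a finitely generated field and some
combination of the differentials `d G_l` is zero in the `x`-directions but not in the
`t`-directions, then the `t`-coordinates are algebraically dependent. -/
theorem not_algebraicIndependent_of_jacobian
    {K L ι τ κ : Type*} [Field K] [CharZero K] [Field L] [Algebra K L]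
    [Algebra.EssFiniteType K L] [Fintype ι] [Fintype τ] [Fintype κ]
    (G : κ → MvPolynomial (τ ⊕ ι) K) (y : τ ⊕ ι → L) (c : κ → L)
    (hG : ∀ l, aeval y (G l) = 0)
    (hx : ∀ i, ∑ l, c l * aeval y (pderiv (Sum.inr i) (G l)) = 0)
    (ht : ∃ m, ∑ l, c l * aeval y (pderiv (Sum.inl m) (G l)) ≠ 0) :
    ¬ AlgebraicIndependent K (y ∘ Sum.inl) := by
  intro h
  obtain ⟨m, hm⟩ := ht
  refine hm (Fintype.linearIndependent_iff.1 h.linearIndependent_kaehlerDifferential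
    (fun m => ∑ l, c l * aeval y (pderiv (Sum.inl m) (G l))) ?_ m)
  have h0 : ∑ l, c l • KaehlerDifferential.D K L (aeval y (G l)) = 0 := by simp [hG]
  simp only [Derivation.map_mvPolynomial_aeval, Finset.smul_sum, smul_smul] at h0
  rw [Finset.sum_comm, Fintype.sum_sum_type] at h0
  simpa only [Function.comp_apply, ← Finset.sum_smul, hx, zero_smul, Finset.sum_const_zero,
    add_zero] using h0

/-- Parametric transversality: for a family of equations `G_l(t, x) = 0`, the parameters `t` for
which some combination of the gradients at a solution `x` is zero in the `x`-directions but not in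
the `t`-directions lie in a proper hypersurface. -/
theorem exists_ne_zero_eval_eq_zero_of_jacobian
    {K ι τ κ : Type*} [Field K] [CharZero K] [Fintype ι] [Fintype τ] [Fintype κ]
    (G : κ → MvPolynomial (τ ⊕ ι) K) :
    ∃ h : MvPolynomial τ K, h ≠ 0 ∧ ∀ (t : τ → K) (x : ι → K) (c : κ → K),
      (∀ l, eval (Sum.elim t x) (G l) = 0) →
      (∀ i, ∑ l, c l * eval (Sum.elim t x) (pderiv (Sum.inr i) (G l)) = 0) →
      (∃ m, ∑ l, c l * eval (Sum.elim t x) (pderiv (Sum.inl m) (G l)) ≠ 0) →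
      eval t h = 0 := by
  classical
  let E : τ ⊕ ι → MvPolynomial ((τ ⊕ ι) ⊕ κ) K := fun s =>
    ∑ l, X (Sum.inr l) * rename Sum.inl (pderiv s (G l))
  let I : Ideal (MvPolynomial ((τ ⊕ ι) ⊕ κ) K) := Ideal.span
    (Set.range (fun l => rename Sum.inl (G l)) ∪ Set.range (fun i => E (Sum.inr i)))
  have key : ∀ P : Ideal (MvPolynomial ((τ ⊕ ι) ⊕ κ) K), P.IsPrime → I ≤ P →
      (∃ m, E (Sum.inl m) ∉ P) → ∃ h : MvPolynomial τ K, h ≠ 0 ∧ rename (Sum.inl ∘ Sum.inl) h ∈ P := by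
    intro P hP hIP ⟨m, hm⟩
    let B := MvPolynomial ((τ ⊕ ι) ⊕ κ) K ⧸ P
    let L := FractionRing B
    let φ : MvPolynomial ((τ ⊕ ι) ⊕ κ) K →ₐ[K] L :=
      (IsScalarTower.toAlgHom K B L).comp (Ideal.Quotient.mkₐ K P)
    have hφ : ∀ a, φ a = 0 ↔ a ∈ P := by
      intro a
      rw [← Ideal.Quotient.eq_zero_iff_mem]
      exact (map_eq_zero_iff _ (IsFractionRing.injective B L))
    have : Algebra.EssFiniteType B L := .of_isLocalization _ (nonZeroDivisors B)
    have : Algebra.EssFiniteType K L := .comp K B L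
    have haev : ∀ p : MvPolynomial (τ ⊕ ι) K,
        aeval (fun s => φ (X (Sum.inl s))) p = φ (rename Sum.inl p) := by
      intro p
      rw [← AlgHom.comp_apply]
      congr 1
      ext s
      simp
    have hE : ∀ s, ∑ l, φ (X (Sum.inr l)) *
        aeval (fun s => φ (X (Sum.inl s))) (pderiv s (G l)) = φ (E s) := by
      intro s
      simp only [haev, E, map_sum, map_mul]
    have hna := not_algebraicIndependent_of_jacobian G (fun s => φ (X (Sum.inl s)))
      (fun l => φ (X (Sum.inr l)))
      (fun l => by
        rw [haev, hφ]
        exact hIP (Ideal.subset_span (Or.inl ⟨l, rfl⟩)))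
      (fun i => by
        rw [hE, hφ]
        exact hIP (Ideal.subset_span (Or.inr ⟨i, rfl⟩)))
      ⟨m, by rwa [hE, Ne, hφ]⟩
    rw [algebraicIndependent_iff] at hna
    push Not at hna
    obtain ⟨h, h0, hne⟩ := hna
    refine ⟨h, hne, ?_⟩
    rw [← hφ, ← h0, ← rename_rename, ← haev, aeval_rename]
  choose! H hH0 hHP using key
  have hfin : I.minimalPrimes.Finite := Ideal.finite_minimalPrimes_of_isNoetherianRing _ I
  let S := hfin.toFinset.filter fun P => ∃ m, E (Sum.inl m) ∉ P
  have hS : ∀ P ∈ S, P ∈ I.minimalPrimes ∧ ∃ m, E (Sum.inl m) ∉ P := by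
    intro P hP
    simpa [S] using hP
  refine ⟨∏ P ∈ S, H P, Finset.prod_ne_zero_iff.2 fun P hP =>
    hH0 P (hS P hP).1.1.1 (hS P hP).1.1.2 (hS P hP).2, ?_⟩
  intro t x c hG hx ⟨m, hm⟩
  let ψ : MvPolynomial ((τ ⊕ ι) ⊕ κ) K →+* K := eval (Sum.elim (Sum.elim t x) c)
  have hψ : ∀ p, ψ (rename Sum.inl p) = eval (Sum.elim t x) p := by
    intro p
    simp only [ψ, eval_rename, Sum.elim_comp_inl]
  have hψE : ∀ s, ψ (E s) = ∑ l, c l * eval (Sum.elim t x) (pderiv s (G l)) := by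
    intro s
    simp only [E, map_sum, map_mul, hψ]
    simp [ψ]
  have hI : I ≤ RingHom.ker ψ := by
    refine Ideal.span_le.2 ?_
    rintro _ (⟨l, rfl⟩ | ⟨i, rfl⟩)
    · exact (hψ _).trans (hG l)
    · exact (hψE _).trans (hx i)
  have : (RingHom.ker ψ).IsPrime := RingHom.ker_isPrime ψ
  obtain ⟨P, hP, hPk⟩ := Ideal.exists_minimalPrimes_le hI
  have hmP : E (Sum.inl m) ∉ P := fun h => hm ((hψE _).symm.trans (hPk h))
  have h1 : ψ (rename (Sum.inl ∘ Sum.inl) (H P)) = 0 := hPk (hHP P hP.1.1 hP.1.2 ⟨m, hmP⟩)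
  rw [map_prod]
  refine Finset.prod_eq_zero (i := P) (by simpa [S] using ⟨hP, m, hmP⟩) ?_
  rw [← h1, ← rename_rename, hψ, eval_rename, Sum.elim_comp_inl]

/-- A unipotent triangular change of coordinates `w` of `v` such that each index has `v i = 0` or
`w i = 0` forces `v = 0`. -/
theorem eq_zero_of_triangular {k : ℕ} {R : Type*} [CommRing R] (b : Fin k → Fin k → R)
    (v w : Fin k → R) (hw : ∀ j, w j = v j + ∑ i ∈ Finset.univ.filter (· < j), b j i * v i)
    (h : ∀ i, v i = 0 ∨ w i = 0) (j : Fin k) : v j = 0 := by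
  induction j using WellFoundedLT.induction with
  | ind j ih =>
    refine (h j).elim id fun hj => ?_
    rw [hw, Finset.sum_eq_zero, add_zero] at hj
    · exact hj
    · intro i hi
      rw [ih i (Finset.mem_filter.1 hi).2, mul_zero]

theorem LinearIndependent.of_triangular {k : ℕ} {R M : Type*} [CommRing R] [AddCommGroup M]
    [Module R M] (b : Fin k → Fin k → R) (v w : Fin k → M)
    (hw : ∀ j, w j = v j + ∑ i ∈ Finset.univ.filter (· < j), b j i • v i)
    (hv : LinearIndependent R v) : LinearIndependent R w := by
  rw [Fintype.linearIndependent_iff] at hv ⊢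
  intro c hc
  have h : ∑ i, (c i + ∑ l ∈ Finset.univ.filter (i < ·), c l * b l i) • v i = 0 := by
    rw [← hc]
    simp only [hw, smul_add, add_smul, Finset.sum_add_distrib, Finset.sum_smul, Finset.smul_sum,
      smul_smul, Finset.sum_filter, smul_ite, smul_zero, ite_smul, zero_smul]
    rw [Finset.sum_comm]
  intro j
  induction j using WellFoundedGT.induction with
  | ind j ih =>
    have hj := hv _ h j
    rwa [Finset.sum_eq_zero, add_zero] at hj
    intro l hl
    rw [ih l (Finset.mem_filter.1 hl).2, zero_mul]

theorem eval_pderiv_aeval_sumElim {R τ ι : Type*} [CommRing R] [Fintype τ] [Fintype ι]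
    (t : τ → R) (x : ι → R) (i : ι) (p : MvPolynomial (τ ⊕ ι) R) :
    eval x (pderiv i (aeval (Sum.elim (fun m => C (t m)) X : τ ⊕ ι → MvPolynomial ι R) p)) =
      eval (Sum.elim t x) (pderiv (Sum.inr i) p) := by
  classical
  have h : ∀ q : MvPolynomial (τ ⊕ ι) R, eval x (aeval
      (Sum.elim (fun m => C (t m)) X : τ ⊕ ι → MvPolynomial ι R) q) = eval (Sum.elim t x) q := by
    intro q
    rw [← coe_aeval_eq_eval, ← coe_aeval_eq_eval]
    simp only [RingHom.coe_coe]
    rw [← AlgHom.comp_apply]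
    congr 1
    ext (s | s) <;> simp
  rw [Derivation.map_mvPolynomial_aeval]
  simp only [Fintype.sum_sum_type, map_add, map_sum, smul_eq_mul, map_mul, h]
  simp [pderiv_X, Pi.single_apply]

/-- The generic member of the family of modified equations, in the parameters `t (l, i, s)`
and the coordinates: `f_l + Σ_{i<l} Σ_s t_{l,i,s} X_s ^ (d_l - d_i) f_i`. -/
noncomputable def genericEquation {k : ℕ} {ι R : Type*} [CommRing R] [Fintype ι] (dd : Fin k → ℕ)
    (f : Fin k → MvPolynomial ι R) (l : Fin k) :
    MvPolynomial ((Fin k × Fin k × ι) ⊕ ι) R :=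
  rename Sum.inr (f l) + ∑ i ∈ Finset.univ.filter (· < l),
    (∑ s, X (Sum.inl (l, i, s)) * rename Sum.inr (X s ^ (dd l - dd i))) * rename Sum.inr (f i)

theorem pderiv_inl_rename_inr {R τ ι : Type*} [CommRing R] (m : τ) (p : MvPolynomial ι R) :
    pderiv (Sum.inl m) (rename (Sum.inr : ι → τ ⊕ ι) p) = 0 := by
  classical
  refine pderiv_eq_zero_of_notMem_vars fun h => ?_
  have := vars_rename _ _ h
  simp at this

theorem eval_pderiv_inl_genericEquation {k : ℕ} {ι R : Type*} [CommRing R] [Fintype ι]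
    (dd : Fin k → ℕ) (f : Fin k → MvPolynomial ι R) (l l' i : Fin k) (hi : i < l) (s : ι)
    (t : Fin k × Fin k × ι → R) (x : ι → R) :
    eval (Sum.elim t x) (pderiv (Sum.inl (l, i, s)) (genericEquation dd f l')) =
      if l' = l then x s ^ (dd l - dd i) * eval x (f i) else 0 := by
  classical
  have hr : ∀ p : MvPolynomial ι R, eval (Sum.elim t x) (rename Sum.inr p) = eval x p := by
    intro p
    rw [eval_rename, Sum.elim_comp_inr]
  simp only [genericEquation, map_add, map_sum, pderiv_inl_rename_inr, Derivation.leibniz,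
    zero_add, pderiv_X, hr, smul_eq_mul, map_mul, mul_zero]
  split_ifs with h
  · subst h
    rw [Finset.sum_eq_single_of_mem i (by simpa using hi), Finset.sum_eq_single_of_mem s (by simp)]
    · simp [mul_comm]
    · intro s' _ hs'
      simp [hs']
    · intro i' _ hi'
      simp [hi']
  · simp [h]

theorem eval_genericEquation {k : ℕ} {ι R : Type*} [CommRing R] [Fintype ι] (dd : Fin k → ℕ)
    (f : Fin k → MvPolynomial ι R) (l : Fin k) (t : Fin k × Fin k × ι → R) (x : ι → R) :
    eval (Sum.elim t x) (genericEquation dd f l) = eval x (f l + ∑ i ∈ Finset.univ.filter (· < l),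
      (∑ s, C (t (l, i, s)) * X s ^ (dd l - dd i)) * f i) := by
  simp [genericEquation, eval_rename]

theorem aeval_genericEquation {k : ℕ} {ι R : Type*} [CommRing R] [Fintype ι] (dd : Fin k → ℕ)
    (f : Fin k → MvPolynomial ι R) (l : Fin k) (t : Fin k × Fin k × ι → R) :
    aeval (Sum.elim (fun m => C (t m)) X : _ → MvPolynomial ι R) (genericEquation dd f l) =
      f l + ∑ i ∈ Finset.univ.filter (· < l),
        (∑ s, C (t (l, i, s)) * X s ^ (dd l - dd i)) * f i := by
  simp only [genericEquation, map_add, map_sum, map_mul, aeval_rename, aeval_X, Sum.elim_comp_inr,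
    Sum.elim_inl, aeval_X_left_apply]

/-- **Step 1 (good equations via Bertini).**  If `d_1 ≤ ⋯ ≤ d_k` and `V_sing` is finite, then
there are homogeneous polynomials `a_{j,i}` of degree `d_j - d_i` (for `i < j`) such that the
modified equations `f_j' = f_j + Σ_{i<j} a_{j,i} f_i` define the same variety `V`, and for each
`j` every singular point of `Z_j = {f_j' = ⋯ = f_k' = 0}` lies in `V_sing`. -/
theorem good_equations_exist
    (n k N : ℕ) (hn : 1 ≤ n) (hk : 1 ≤ k) (hN : N = n + k)
    (dd : Fin k → ℕ) (hmono : Monotone dd)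
    (f : Fin k → MvPolynomial (Fin (N + 1)) ℂ)
    (hf : ∀ a, (f a).IsHomogeneous (dd a))
    (Vsing : Set (Projectivization ℂ (Fin (N + 1) → ℂ)))
    -- `Vsing` is the singular locus of `V`
    (hVsing : Vsing = {P | ∃ x, ∃ hx : x ≠ 0, P = Projectivization.mk ℂ x hx ∧
        (∀ a, eval x (f a) = 0) ∧
        ¬ LinearIndependent ℂ fun a => pgrad (f a) x})
    -- `V_sing` is finite
    (hVsingFin : Vsing.Finite) :
    ∃ a : Fin k → Fin k → MvPolynomial (Fin (N + 1)) ℂ,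
      -- the `a_{j,i}` (for `i < j`) are homogeneous of degree `d_j - d_i`
      (∀ j i : Fin k, i < j → (a j i).IsHomogeneous (dd j - dd i)) ∧
      ∀ f' : Fin k → MvPolynomial (Fin (N + 1)) ℂ,
        -- with `f_j' = f_j + Σ_{i<j} a_{j,i} f_i`,
        (∀ j, f' j = f j + ∑ i ∈ Finset.univ.filter (· < j), a j i * f i) →
        -- the common zero set of the `f_j'` in `ℙ^N(ℂ)` equals that of the `f_j`
        -- (i.e. equals `V`), and
        ((∀ x : Fin (N + 1) → ℂ, x ≠ 0 →
            ((∀ j, eval x (f' j) = 0) ↔ (∀ j, eval x (f j) = 0))) ∧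
          -- every singular point of `Z_j = {f_j' = ⋯ = f_k' = 0}` lies in `V_sing`
          ∀ j : Fin k, ∀ x, ∀ hx : x ≠ 0,
            (∀ l : Fin k, j ≤ l → eval x (f' l) = 0) →
            ¬ LinearIndependent ℂ (fun l : {l : Fin k // j ≤ l} => pgrad (f' l) x) →
            Projectivization.mk ℂ x hx ∈ Vsing) := by
  have hgen : ∀ j : Fin k, ∃ h : MvPolynomial (Fin k × Fin k × Fin (N + 1)) ℂ, h ≠ 0 ∧
      ∀ (t) (x : Fin (N + 1) → ℂ) (c : {l : Fin k // j ≤ l} → ℂ),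
      (∀ l : {l : Fin k // j ≤ l}, eval (Sum.elim t x) (genericEquation dd f l) = 0) →
      (∀ i, ∑ l : {l : Fin k // j ≤ l},
        c l * eval (Sum.elim t x) (pderiv (Sum.inr i) (genericEquation dd f l)) = 0) →
      (∃ m, ∑ l : {l : Fin k // j ≤ l},
        c l * eval (Sum.elim t x) (pderiv (Sum.inl m) (genericEquation dd f l)) ≠ 0) →
      eval t h = 0 := fun j =>
    exists_ne_zero_eval_eq_zero_of_jacobian fun l : {l : Fin k // j ≤ l} => genericEquation dd f l
  choose h hne hbad using hgen
  obtain ⟨t, ht⟩ : ∃ t, eval t (∏ j, h j) ≠ 0 := by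
    by_contra! hcon
    exact Finset.prod_ne_zero_iff.2 (fun j _ => hne j) (funext fun t => by simpa using hcon t)
  rw [map_prod, Finset.prod_ne_zero_iff] at ht
  refine ⟨fun j i => ∑ s, C (t (j, i, s)) * X s ^ (dd j - dd i), ?_, ?_⟩
  · intro j i _
    refine IsHomogeneous.sum _ _ _ fun s _ => ?_
    simpa using (isHomogeneous_C _ (t (j, i, s))).mul ((isHomogeneous_X ℂ s).pow (dd j - dd i))
  intro f' hf'
  have hev : ∀ x j, eval x (f' j) = eval x (f j) + ∑ i ∈ Finset.univ.filter (· < j),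
      eval x (∑ s, C (t (j, i, s)) * X s ^ (dd j - dd i)) * eval x (f i) := by
    intro x j
    simp only [hf', map_add, map_sum, map_mul]
  have hzero : ∀ x, (∀ i, eval x (f i) = 0 ∨ eval x (f' i) = 0) → ∀ i, eval x (f i) = 0 :=
    fun x => eq_zero_of_triangular _ _ _ (hev x)
  refine ⟨fun x _ => ⟨fun hx => hzero x fun i => Or.inr (hx i), fun hx j => ?_⟩, ?_⟩
  · rw [hev, hx, Finset.sum_eq_zero, add_zero]
    intro i _
    rw [hx, mul_zero]
  intro j x hx hxZ hdep
  have hV : ∀ i, eval x (f i) = 0 := by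
    obtain ⟨c, hc, l, hl⟩ := Fintype.not_linearIndependent_iff.1 hdep
    refine hzero x fun i => ?_
    by_cases hil : i < l
    · by_contra! hcon
      obtain ⟨s, hs⟩ := Function.ne_iff.1 hx
      refine ht j (Finset.mem_univ j) (hbad j t x c ?_ ?_ ⟨(l, i, s), ?_⟩)
      · intro l'
        rw [eval_genericEquation, ← hf']
        exact hxZ l' l'.2
      · intro s'
        have := congrFun hc s'
        simpa [pgrad, ← eval_pderiv_aeval_sumElim, aeval_genericEquation, ← hf', -aeval_eq_bind₁]
          using this
      · simp_rw [eval_pderiv_inl_genericEquation dd f l _ i hil, Subtype.coe_inj, mul_ite,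
          mul_zero]
        rw [Fintype.sum_ite_eq']
        exact mul_ne_zero hl (mul_ne_zero (pow_ne_zero _ hs) hcon.1)
    · exact Or.inr (hxZ i (l.2.trans (not_lt.1 hil)))
  rw [hVsing]
  refine ⟨x, hx, rfl, hV, fun hind => hdep ?_⟩
  have hgrad : ∀ l, pgrad (f' l) x = pgrad (f l) x + ∑ i ∈ Finset.univ.filter (· < l),
      eval x (∑ s, C (t (l, i, s)) * X s ^ (dd l - dd i)) • pgrad (f i) x := by
    intro l
    ext s
    simp only [pgrad, hf', map_add, map_sum, Derivation.leibniz, smul_eq_mul, map_mul, hV,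
      Pi.add_apply, Finset.sum_apply, Pi.smul_apply, zero_mul, add_zero]
  exact (hind.of_triangular _ _ _ hgrad).comp _ Subtype.val_injective
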